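/- arXiv:2301.10806 — 2 statements merged into one kernel-verified Lean document; each statement's English description precedes it below -/
import Mathlib

section
/- Let μ ∈ V_n be a nonzero soliton such that 0 is an eigenvalue of D_μ := M_μ − c_μ·I, where c_μ := −Tr(M_μ²)/‖μ‖². Then E_n(μ) ≤ 1, i.e., ‖M_μ‖ ≤ ‖μ‖². -/
open Matrix

noncomputable section

/-- `Vn n` is the space of `n`-dimensional commutative complex algebras, i.e. symmetric
ℂ-bilinear maps `ℂⁿ × ℂⁿ → ℂⁿ`, encoded by structure constants with respect to the
standard basis: `μ i j k` is the `e k`-coordinate of `μ(e i, e j)`. -/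
abbrev Vn (n : ℕ) : Type := Fin n → Fin n → Fin n → ℂ

namespace Vn

variable {n : ℕ}

/-- symmetry (commutativity) of the multiplication -/
def IsSymm (μ : Vn n) : Prop := ∀ i j k, μ i j k = μ j i k

/-- the product `μ(x, y)` -/
def mul (μ : Vn n) (x y : Fin n → ℂ) : Fin n → ℂ :=
  fun k => ∑ i, ∑ j, x i * y j * μ i j k

/-- left multiplication `L^μ_x`, as a matrix -/
def L (μ : Vn n) (x : Fin n → ℂ) : Matrix (Fin n) (Fin n) ℂ :=
  Matrix.of fun k j => ∑ i, x i * μ i j k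

/-- the standard Hermitian inner product on `ℂⁿ` (linear in the first variable) -/
def herm (x y : Fin n → ℂ) : ℂ := ∑ i, x i * star (y i)

/-- the moment matrix `M_μ = -2 ∑ᵢ (L_{xᵢ})* L_{xᵢ} + ∑ᵢ L_{xᵢ} (L_{xᵢ})*`,
computed with respect to the standard orthonormal basis of `ℂⁿ` -/
def Mmat (μ : Vn n) : Matrix (Fin n) (Fin n) ℂ :=
  (-2 : ℂ) • ∑ i, (L μ (Pi.single i 1))ᴴ * L μ (Pi.single i 1)
    + ∑ i, L μ (Pi.single i 1) * (L μ (Pi.single i 1))ᴴ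

/-- the Hermitian product on `Vn n` -/
def innerV (μ ν : Vn n) : ℂ := ∑ i, ∑ j, ∑ k, μ i j k * star (ν i j k)

/-- the squared norm `‖μ‖²` on `Vn n` -/
def normSqV (μ : Vn n) : ℝ := ∑ i, ∑ j, ∑ k, Complex.normSq (μ i j k)

/-- the infinitesimal change-of-basis action of `gl(n, ℂ)` on `Vn n`:
`(A·μ)(x,y) = A(μ(x,y)) - μ(Ax,y) - μ(x,Ay)` -/
def glAct (A : Matrix (Fin n) (Fin n) ℂ) (μ : Vn n) : Vn n :=
  fun i j k =>
    (A *ᵥ mul μ (Pi.single i 1) (Pi.single j 1)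
      - mul μ (A *ᵥ Pi.single i 1) (Pi.single j 1)
      - mul μ (Pi.single i 1) (A *ᵥ Pi.single j 1)) k

/-- the change-of-basis action of `GL(n, ℂ)` on `Vn n`:
`(g·μ)(x,y) = g(μ(g⁻¹x, g⁻¹y))` -/
def gAct (g : GL (Fin n) ℂ) (μ : Vn n) : Vn n :=
  fun i j k =>
    ((g : Matrix (Fin n) (Fin n) ℂ) *ᵥ
      mul μ ((↑g⁻¹ : Matrix (Fin n) (Fin n) ℂ) *ᵥ Pi.single i 1)
            ((↑g⁻¹ : Matrix (Fin n) (Fin n) ℂ) *ᵥ Pi.single j 1)) k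

/-- the `GL(n,ℂ)`-orbit (isomorphism class) of `μ` -/
def orbit (μ : Vn n) : Set (Vn n) := { ν | ∃ g : GL (Fin n) ℂ, ν = gAct g μ }

/-- `D` is a derivation of `μ` -/
def IsDeriv (μ : Vn n) (D : Matrix (Fin n) (Fin n) ℂ) : Prop :=
  ∀ x y, D *ᵥ mul μ x y = mul μ (D *ᵥ x) y + mul μ x (D *ᵥ y)

/-- the associator `(a,b,c) = (ab)c - a(bc)` -/
def assoc (μ : Vn n) (a b c : Fin n → ℂ) : Fin n → ℂ :=
  mul μ (mul μ a b) c - mul μ a (mul μ b c)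

/-- `μ` is a Jordan algebra: commutative and satisfying the linearized Jordan identity
`(ab,c,d) + (bd,c,a) + (da,c,b) = 0` -/
def IsJordan (μ : Vn n) : Prop :=
  IsSymm μ ∧ ∀ a b c d : Fin n → ℂ,
    assoc μ (mul μ a b) c d + assoc μ (mul μ b d) c a + assoc μ (mul μ d a) c b = 0

/-- `μ` is a soliton: `μ ≠ 0` and `M_μ · μ ∈ ℝ μ` -/
def IsSoliton (μ : Vn n) : Prop :=
  μ ≠ 0 ∧ ∃ c : ℝ, glAct (Mmat μ) μ = (c : ℂ) • μ

/-- the constant `c_μ = -Tr(M_μ²)/‖μ‖²` -/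
def cconst (μ : Vn n) : ℝ := -(Matrix.trace (Mmat μ * Mmat μ)).re / normSqV μ

/-- `D_μ = M_μ - c_μ • I` -/
def Dmat (μ : Vn n) : Matrix (Fin n) (Fin n) ℂ := Mmat μ - (cconst μ : ℂ) • 1

/-- the energy `E_n(μ) = Tr(M_μ²)/‖μ‖⁴` -/
def energy (μ : Vn n) : ℝ := (Matrix.trace (Mmat μ * Mmat μ)).re / (normSqV μ) ^ 2

/-- the trace form `τ_μ(x, y) = Tr L_{μ(x,y)}` -/
def traceForm (μ : Vn n) (x y : Fin n → ℂ) : ℂ := Matrix.trace (L μ (mul μ x y))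

/-- nondegeneracy of the trace form (Albert's criterion for semisimplicity) -/
def TraceFormNondeg (μ : Vn n) : Prop := ∀ x, (∀ y, traceForm μ x y = 0) → x = 0

end Vn


/-- the squared Frobenius norm `‖A‖² = Tr(A A*)` of a matrix -/
def fnormSq {n : ℕ} (A : Matrix (Fin n) (Fin n) ℂ) : ℝ := (Matrix.trace (A * Aᴴ)).re

namespace Vn

variable {n : ℕ}

lemma L_single (μ : Vn n) (i k j : Fin n) : L μ (Pi.single i 1) k j = μ i j k := by
  simp [L, Pi.single_apply]

lemma Mmat_apply (μ : Vn n) (a b : Fin n) :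
    Mmat μ a b = -2 * ∑ i, ∑ k, star (μ i a k) * μ i b k
      + ∑ i, ∑ j, μ i j a * star (μ i j b) := by
  simp [Mmat, Matrix.sum_apply, Matrix.mul_apply, L_single, Matrix.conjTranspose_apply]

lemma Mmat_conjTranspose (μ : Vn n) : (Mmat μ)ᴴ = Mmat μ := by
  simp [Mmat, Matrix.conjTranspose_sum]

lemma glAct_apply (A : Matrix (Fin n) (Fin n) ℂ) (μ : Vn n) (i j k : Fin n) :
    glAct A μ i j k = ∑ l, A k l * μ i j l - ∑ l, A l i * μ l j k - ∑ l, A l j * μ i l k := by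
  simp [glAct, mul, Matrix.mulVec, dotProduct, Pi.single_apply]

/-- The moment matrix represents `A ↦ ⟨A·μ, μ⟩` with respect to the trace form. -/
lemma innerV_glAct (A : Matrix (Fin n) (Fin n) ℂ) (μ : Vn n) (hμ : IsSymm μ) :
    innerV (glAct A μ) μ = trace (A * Mmat μ) := by
  have h1 : ∑ i, ∑ j, ∑ k, (∑ l, A k l * μ i j l) * star (μ i j k)
      = ∑ a, ∑ b, A a b * ∑ i, ∑ j, μ i j b * star (μ i j a) := by
    simp only [Finset.sum_mul, Finset.mul_sum]
    calc _ = ∑ i, ∑ k, ∑ j, ∑ l, A k l * μ i j l * star (μ i j k) :=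
          Finset.sum_congr rfl fun i _ => Finset.sum_comm
      _ = ∑ k, ∑ i, ∑ l, ∑ j, A k l * μ i j l * star (μ i j k) := by
          rw [Finset.sum_comm]
          exact Finset.sum_congr rfl fun k _ => Finset.sum_congr rfl fun i _ => Finset.sum_comm
      _ = _ := by
          refine Finset.sum_congr rfl fun k _ => ?_
          rw [Finset.sum_comm]
          simp only [mul_assoc]
  have h2 : ∑ i, ∑ j, ∑ k, (∑ l, A l j * μ i l k) * star (μ i j k)
      = ∑ a, ∑ b, A a b * ∑ i, ∑ k, star (μ i b k) * μ i a k := by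
    simp only [Finset.sum_mul, Finset.mul_sum]
    calc _ = ∑ i, ∑ j, ∑ l, ∑ k, A l j * μ i l k * star (μ i j k) :=
          Finset.sum_congr rfl fun i _ => Finset.sum_congr rfl fun j _ => Finset.sum_comm
      _ = ∑ i, ∑ l, ∑ j, ∑ k, A l j * μ i l k * star (μ i j k) :=
          Finset.sum_congr rfl fun i _ => Finset.sum_comm
      _ = _ := by
          rw [Finset.sum_comm]
          refine Finset.sum_congr rfl fun l _ => ?_
          rw [Finset.sum_comm]
          refine Finset.sum_congr rfl fun j _ => Finset.sum_congr rfl fun i _ =>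
            Finset.sum_congr rfl fun k _ => by ring
  have h3 : ∑ i, ∑ j, ∑ k, (∑ l, A l i * μ l j k) * star (μ i j k)
      = ∑ i, ∑ j, ∑ k, (∑ l, A l j * μ i l k) * star (μ i j k) := by
    rw [Finset.sum_comm]
    refine Finset.sum_congr rfl fun i _ => Finset.sum_congr rfl fun j _ =>
      Finset.sum_congr rfl fun k _ => ?_
    rw [hμ j i k]
    congr 1
    exact Finset.sum_congr rfl fun l _ => by rw [hμ l i k]
  simp only [innerV, glAct_apply, sub_mul, Finset.sum_sub_distrib]
  rw [h3, h1, h2]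
  simp only [Matrix.trace, Matrix.diag, Matrix.mul_apply, Mmat_apply, mul_add,
    Finset.sum_add_distrib, mul_left_comm _ (-2 : ℂ), ← Finset.mul_sum]
  ring

lemma innerV_self (μ : Vn n) : innerV μ μ = (normSqV μ : ℂ) := by
  simp [innerV, normSqV, Complex.mul_conj]

lemma normSqV_pos {μ : Vn n} (h : μ ≠ 0) : 0 < normSqV μ := by
  have h0 : ∀ i j k, 0 ≤ Complex.normSq (μ i j k) := fun _ _ _ => Complex.normSq_nonneg _
  refine lt_of_le_of_ne (Finset.sum_nonneg fun i _ => Finset.sum_nonneg fun j _ =>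
    Finset.sum_nonneg fun k _ => h0 i j k) fun h' => h ?_
  funext i j k
  have h1 := (Finset.sum_eq_zero_iff_of_nonneg fun i _ => Finset.sum_nonneg fun j _ =>
    Finset.sum_nonneg fun k _ => h0 i j k).1 h'.symm i (Finset.mem_univ _)
  have h2 := (Finset.sum_eq_zero_iff_of_nonneg fun j _ =>
    Finset.sum_nonneg fun k _ => h0 i j k).1 h1 j (Finset.mem_univ _)
  have h3 := (Finset.sum_eq_zero_iff_of_nonneg fun k _ => h0 i j k).1 h2 k (Finset.mem_univ _)
  simpa using h3

/-- The proportionality factor of a soliton is `-c_μ`. -/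
lemma glAct_Mmat_of_isSoliton {μ : Vn n} (hμ : IsSymm μ) (h : IsSoliton μ) :
    glAct (Mmat μ) μ = (-cconst μ : ℂ) • μ := by
  obtain ⟨h0, c, hc⟩ := h
  have hpos := normSqV_pos h0
  have h1 : (c : ℂ) * normSqV μ = trace (Mmat μ * Mmat μ) := by
    rw [← innerV_glAct _ μ hμ, hc, ← innerV_self]
    simp [innerV, Finset.mul_sum, mul_assoc]
  have h2 := congrArg Complex.re h1
  rw [← Complex.ofReal_mul, Complex.ofReal_re] at h2
  have h3 : -cconst μ = c := by
    rw [cconst, ← h2]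
    field_simp
  rw [hc, ← h3]
  simp

/-- If `A·μ = t μ`, then `A(x²) = t x² + 2 (Ax)x`; stated for an eigenvector `x` of `A`. -/
lemma mulVec_mul_self {μ : Vn n} {A : Matrix (Fin n) (Fin n) ℂ} {t s : ℂ} {x : Fin n → ℂ}
    (h : glAct A μ = t • μ) (hx : A *ᵥ x = s • x) :
    A *ᵥ mul μ x x = (t + 2 * s) • mul μ x x := by
  funext k
  have hx' : ∀ l, ∑ i, A l i * x i = s * x l := fun l => by
    simpa [Matrix.mulVec, dotProduct] using congrFun hx l
  have e : ∑ i, ∑ j, x i * x j * glAct A μ i j k = t * mul μ x x k := by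
    rw [h]
    simp [mul, Finset.mul_sum, mul_left_comm]
  have e1 : ∑ i, ∑ j, x i * x j * ∑ l, A k l * μ i j l = (A *ᵥ mul μ x x) k := by
    simp only [Matrix.mulVec, dotProduct, mul, Finset.mul_sum]
    symm
    rw [Finset.sum_comm]
    refine Finset.sum_congr rfl fun i _ => ?_
    rw [Finset.sum_comm]
    refine Finset.sum_congr rfl fun j _ => Finset.sum_congr rfl fun l _ => by ring
  have e2 : ∑ i, ∑ j, x i * x j * ∑ l, A l i * μ l j k = s * mul μ x x k := by
    calc _ = ∑ l, ∑ j, (∑ i, A l i * x i) * (x j * μ l j k) := by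
          simp only [Finset.mul_sum, Finset.sum_mul]
          rw [Finset.sum_comm]
          symm
          rw [Finset.sum_comm]
          refine Finset.sum_congr rfl fun j _ => ?_
          rw [Finset.sum_comm]
          refine Finset.sum_congr rfl fun i _ => Finset.sum_congr rfl fun l _ => by ring
      _ = _ := by
          simp only [hx', mul, Finset.mul_sum]
          refine Finset.sum_congr rfl fun i _ => Finset.sum_congr rfl fun l _ => by ring
  have e3 : ∑ i, ∑ j, x i * x j * ∑ l, A l j * μ i l k = s * mul μ x x k := by
    calc _ = ∑ i, ∑ l, (∑ j, A l j * x j) * (x i * μ i l k) := by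
          simp only [Finset.mul_sum, Finset.sum_mul]
          refine Finset.sum_congr rfl fun i _ => ?_
          rw [Finset.sum_comm]
          refine Finset.sum_congr rfl fun j _ => Finset.sum_congr rfl fun l _ => by ring
      _ = _ := by
          simp only [hx', mul, Finset.mul_sum]
          refine Finset.sum_congr rfl fun i _ => Finset.sum_congr rfl fun l _ => by ring
  simp only [glAct_apply, mul_sub, Finset.sum_sub_distrib, e1, e2, e3] at e
  simp only [Pi.smul_apply, smul_eq_mul]
  linear_combination e

/-- Pythagoras: splitting off the component of `v` along `star x` for a unit vector `x`. -/
lemma sum_normSq_sub_proj {x : Fin n → ℂ} (hx : ∑ i, Complex.normSq (x i) = 1)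
    (v : Fin n → ℂ) :
    ∑ i, Complex.normSq (v i - star (x i) * ∑ l, x l * v l)
      = ∑ i, Complex.normSq (v i) - Complex.normSq (∑ l, x l * v l) := by
  apply Complex.ofReal_injective
  have hx' : ∑ i, x i * star (x i) = 1 := by
    have := congrArg (fun r : ℝ => (r : ℂ)) hx
    simpa [Complex.mul_conj] using this
  set s := ∑ l, x l * v l with hs
  have hs' : ∑ l, star (x l) * star (v l) = star s := by simp [hs, star_sum]
  simp only [Complex.ofReal_sum, Complex.ofReal_sub, ← Complex.mul_conj]
  calc _ = ∑ i, (v i * star (v i) - star s * (x i * v i) - s * (star (x i) * star (v i))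
            + s * star s * (x i * star (x i))) := by
        refine Finset.sum_congr rfl fun i _ => ?_
        simp
        ring
    _ = _ := by
        rw [Finset.sum_add_distrib, Finset.sum_sub_distrib, Finset.sum_sub_distrib,
          ← Finset.mul_sum, ← Finset.mul_sum, ← Finset.mul_sum, hx', hs', ← hs]
        simp
        ring

lemma normSq_sum_mul_le {x : Fin n → ℂ} (hx : ∑ i, Complex.normSq (x i) = 1)
    (v : Fin n → ℂ) :
    Complex.normSq (∑ l, x l * v l) ≤ ∑ i, Complex.normSq (v i) := by
  have h := sum_normSq_sub_proj hx v
  have : 0 ≤ ∑ i, Complex.normSq (v i - star (x i) * ∑ l, x l * v l) :=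
    Finset.sum_nonneg fun i _ => Complex.normSq_nonneg _
  linarith

lemma normSq_add_normSq_le {x y : Fin n → ℂ} (hx : ∑ i, Complex.normSq (x i) = 1)
    (hy : ∑ i, Complex.normSq (y i) = 1) (hxy : ∑ i, y i * star (x i) = 0)
    (v : Fin n → ℂ) :
    Complex.normSq (∑ l, x l * v l) + Complex.normSq (∑ l, y l * v l)
      ≤ ∑ i, Complex.normSq (v i) := by
  have h := normSq_sum_mul_le hy fun i => v i - star (x i) * ∑ l, x l * v l
  rw [sum_normSq_sub_proj hx v] at h
  have e : ∑ l, y l * (v l - star (x l) * ∑ l, x l * v l) = ∑ l, y l * v l := by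
    simp only [mul_sub, Finset.sum_sub_distrib, ← mul_assoc, ← Finset.sum_mul, hxy]
    simp
  rw [e] at h
  linarith

/-- For a symmetric bilinear form `B` and a unit vector `x`, the entries of `B` in the row and
the column of `x` have total squared norm at most that of `B`. -/
lemma two_mul_sum_normSq_le {x : Fin n → ℂ} (hx : ∑ i, Complex.normSq (x i) = 1)
    {B : Fin n → Fin n → ℂ} (hB : ∀ i j, B i j = B j i) :
    2 * ∑ j, Complex.normSq (∑ i, x i * B i j)
      ≤ ∑ i, ∑ j, Complex.normSq (B i j)
        + Complex.normSq (∑ j, x j * ∑ i, x i * B i j) := by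
  set b : Fin n → ℂ := fun j => ∑ i, x i * B i j with hb
  have h1 : ∑ j, ∑ i, Complex.normSq (B i j - star (x i) * b j)
      = ∑ i, ∑ j, Complex.normSq (B i j) - ∑ j, Complex.normSq (b j) := by
    rw [Finset.sum_comm (f := fun i j => Complex.normSq (B i j)), ← Finset.sum_sub_distrib]
    exact Finset.sum_congr rfl fun j _ => sum_normSq_sub_proj hx fun i => B i j
  have h2 : ∑ i, Complex.normSq (b i - star (x i) * ∑ j, x j * b j)
      ≤ ∑ j, ∑ i, Complex.normSq (B i j - star (x i) * b j) := by
    rw [Finset.sum_comm]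
    refine Finset.sum_le_sum fun i _ => ?_
    have h := normSq_sum_mul_le hx fun j => B i j - star (x i) * b j
    have e : ∑ j, x j * (B i j - star (x i) * b j) = b i - star (x i) * ∑ j, x j * b j := by
      simp only [mul_sub, Finset.sum_sub_distrib, Finset.mul_sum, hb]
      congr 1
      · exact Finset.sum_congr rfl fun j _ => by rw [hB]
      · refine Finset.sum_congr rfl fun j _ => Finset.sum_congr rfl fun l _ => by ring
    rwa [e] at h
  rw [sum_normSq_sub_proj hx b, h1] at h2
  change 2 * ∑ j, Complex.normSq (b j) ≤ _ + Complex.normSq (∑ j, x j * b j)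
  linarith

/-- the squared Hilbert-Schmidt norm of left multiplication by `x` -/
def leftNormSq (μ : Vn n) (x : Fin n → ℂ) : ℝ :=
  ∑ j, ∑ k, Complex.normSq (∑ i, x i * μ i j k)

/-- the sum of the squared norms of the `x`-components of the products of basis vectors -/
def compNormSq (μ : Vn n) (x : Fin n → ℂ) : ℝ :=
  ∑ i, ∑ j, Complex.normSq (∑ k, star (x k) * μ i j k)

lemma compNormSq_nonneg (μ : Vn n) (x : Fin n → ℂ) : 0 ≤ compNormSq μ x :=
  Finset.sum_nonneg fun _ _ => Finset.sum_nonneg fun _ _ => Complex.normSq_nonneg _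

lemma dotProduct_Mmat (μ : Vn n) (hμ : IsSymm μ) (x : Fin n → ℂ) :
    ∑ a, star (x a) * (Mmat μ *ᵥ x) a
      = ((-2 * leftNormSq μ x + compNormSq μ x : ℝ) : ℂ) := by
  have h1 : (leftNormSq μ x : ℂ)
      = ∑ a, ∑ b, star (x a) * (∑ i, ∑ k, star (μ i a k) * μ i b k) * x b := by
    simp only [leftNormSq, Complex.ofReal_sum, ← Complex.mul_conj, map_sum, map_mul,
      Finset.mul_sum, Finset.sum_mul]
    calc _ = ∑ i, ∑ k, ∑ a, ∑ b, star (x a) * (star (μ i a k) * μ i b k) * x b := by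
          refine Finset.sum_congr rfl fun i _ => Finset.sum_congr rfl fun k _ => ?_
          refine Finset.sum_congr rfl fun a _ => Finset.sum_congr rfl fun b _ => ?_
          rw [hμ i a, hμ i b]
          simp
          ring
      _ = ∑ i, ∑ a, ∑ b, ∑ k, star (x a) * (star (μ i a k) * μ i b k) * x b := by
          refine Finset.sum_congr rfl fun i _ => ?_
          rw [Finset.sum_comm]
          exact Finset.sum_congr rfl fun a _ => Finset.sum_comm
      _ = _ := by
          rw [Finset.sum_comm]
          exact Finset.sum_congr rfl fun a _ => Finset.sum_comm
  have h2 : (compNormSq μ x : ℂ)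
      = ∑ a, ∑ b, star (x a) * (∑ i, ∑ j, μ i j a * star (μ i j b)) * x b := by
    simp only [compNormSq, Complex.ofReal_sum, ← Complex.mul_conj, map_sum, map_mul,
      Finset.mul_sum, Finset.sum_mul]
    calc _ = ∑ i, ∑ k, ∑ a, ∑ b, star (x a) * (μ i k a * star (μ i k b)) * x b := by
          refine Finset.sum_congr rfl fun i _ => Finset.sum_congr rfl fun k _ => ?_
          rw [Finset.sum_comm]
          refine Finset.sum_congr rfl fun a _ => Finset.sum_congr rfl fun b _ => ?_
          simp
          ring
      _ = ∑ i, ∑ a, ∑ b, ∑ k, star (x a) * (μ i k a * star (μ i k b)) * x b := by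
          refine Finset.sum_congr rfl fun i _ => ?_
          rw [Finset.sum_comm]
          exact Finset.sum_congr rfl fun a _ => Finset.sum_comm
      _ = _ := by
          rw [Finset.sum_comm]
          exact Finset.sum_congr rfl fun a _ => Finset.sum_comm
  push_cast
  rw [h1, h2, Finset.mul_sum, ← Finset.sum_add_distrib]
  refine Finset.sum_congr rfl fun a _ => ?_
  rw [Finset.mul_sum, ← Finset.sum_add_distrib, Matrix.mulVec, dotProduct, Finset.mul_sum]
  refine Finset.sum_congr rfl fun b _ => ?_
  rw [Mmat_apply]
  ring

lemma eigenvalue_eq {μ : Vn n} (hμ : IsSymm μ) {c : ℝ} {x : Fin n → ℂ}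
    (hx : ∑ i, Complex.normSq (x i) = 1) (h : Mmat μ *ᵥ x = (c : ℂ) • x) :
    c = -2 * leftNormSq μ x + compNormSq μ x := by
  apply Complex.ofReal_injective
  rw [← dotProduct_Mmat μ hμ, h]
  have hx' : ∑ i, star (x i) * x i = 1 := by
    have := congrArg (fun r : ℝ => (r : ℂ)) hx
    simpa [← Complex.mul_conj, mul_comm] using this
  simp only [Pi.smul_apply, smul_eq_mul, mul_left_comm, ← Finset.mul_sum, hx', mul_one]

lemma leftNormSq_add_le (μ : Vn n) {x y : Fin n → ℂ} (hx : ∑ i, Complex.normSq (x i) = 1)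
    (hy : ∑ i, Complex.normSq (y i) = 1) (hxy : ∑ i, y i * star (x i) = 0) :
    leftNormSq μ x + leftNormSq μ y ≤ normSqV μ := by
  have e : normSqV μ = ∑ j, ∑ k, ∑ i, Complex.normSq (μ i j k) := by
    rw [normSqV, Finset.sum_comm]
    exact Finset.sum_congr rfl fun j _ => Finset.sum_comm
  rw [e, leftNormSq, leftNormSq, ← Finset.sum_add_distrib]
  refine Finset.sum_le_sum fun j _ => ?_
  rw [← Finset.sum_add_distrib]
  exact Finset.sum_le_sum fun k _ => normSq_add_normSq_le hx hy hxy fun i => μ i j k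

lemma two_mul_leftNormSq_le {μ : Vn n} (hμ : IsSymm μ) {x : Fin n → ℂ}
    (hx : ∑ i, Complex.normSq (x i) = 1) :
    2 * leftNormSq μ x ≤ normSqV μ + ∑ k, Complex.normSq (mul μ x x k) := by
  have e : normSqV μ = ∑ k, ∑ i, ∑ j, Complex.normSq (μ i j k) := by
    symm
    rw [normSqV]
    rw [Finset.sum_comm]
    exact Finset.sum_congr rfl fun i _ => Finset.sum_comm
  rw [e, leftNormSq, Finset.sum_comm, Finset.mul_sum, ← Finset.sum_add_distrib]
  refine Finset.sum_le_sum fun k _ => ?_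
  have h := two_mul_sum_normSq_le hx (B := fun i j => μ i j k) fun i j => hμ i j k
  have e2 : ∑ j, x j * ∑ i, x i * μ i j k = mul μ x x k := by
    simp only [mul, Finset.mul_sum]
    rw [Finset.sum_comm]
    refine Finset.sum_congr rfl fun i _ => Finset.sum_congr rfl fun j _ => by ring
  rwa [e2] at h

lemma normSq_inner_mul_self_le (μ : Vn n) {x : Fin n → ℂ}
    (hx : ∑ i, Complex.normSq (x i) = 1) :
    Complex.normSq (∑ k, star (x k) * mul μ x x k) ≤ compNormSq μ x := by
  have e : ∑ k, star (x k) * mul μ x x k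
      = ∑ i, x i * ∑ j, x j * ∑ k, star (x k) * μ i j k := by
    simp only [mul, Finset.mul_sum]
    rw [Finset.sum_comm]
    refine Finset.sum_congr rfl fun i _ => ?_
    rw [Finset.sum_comm]
    refine Finset.sum_congr rfl fun j _ => Finset.sum_congr rfl fun k _ => by ring
  rw [e]
  exact (normSq_sum_mul_le hx _).trans
    (Finset.sum_le_sum fun i _ => normSq_sum_mul_le hx _)

lemma exists_smul_unit {x : Fin n → ℂ} (hx : x ≠ 0) :
    ∃ r : ℂ, ∑ i, Complex.normSq ((r • x) i) = 1 := by
  have hnn : 0 ≤ ∑ i, Complex.normSq (x i) :=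
    Finset.sum_nonneg fun _ _ => Complex.normSq_nonneg _
  have hpos : 0 < ∑ i, Complex.normSq (x i) := by
    refine lt_of_le_of_ne hnn fun h => hx ?_
    funext i
    simpa using (Finset.sum_eq_zero_iff_of_nonneg fun i _ => Complex.normSq_nonneg (x i)).1
      h.symm i (Finset.mem_univ _)
  refine ⟨((Real.sqrt (∑ i, Complex.normSq (x i)))⁻¹ : ℝ), ?_⟩
  simp only [Pi.smul_apply, smul_eq_mul, Complex.normSq_mul, ← Finset.mul_sum,
    Complex.normSq_ofReal]
  rw [← mul_inv, Real.mul_self_sqrt hnn, inv_mul_cancel₀ hpos.ne']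

lemma neg_cconst_le {μ : Vn n} (hμ : IsSymm μ) (hsol : IsSoliton μ)
    (hker : ∃ x : Fin n → ℂ, x ≠ 0 ∧ Dmat μ *ᵥ x = 0) : -cconst μ ≤ normSqV μ := by
  obtain ⟨x₀, hx₀, hD⟩ := hker
  obtain ⟨r, hx⟩ := exists_smul_unit hx₀
  have hM₀ : Mmat μ *ᵥ x₀ = (cconst μ : ℂ) • x₀ := by
    rw [Dmat, Matrix.sub_mulVec, Matrix.smul_mulVec, Matrix.one_mulVec] at hD
    exact sub_eq_zero.1 hD
  have hM : Mmat μ *ᵥ (r • x₀) = (cconst μ : ℂ) • (r • x₀) := by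
    rw [Matrix.mulVec_smul, hM₀, smul_comm]
  generalize r • x₀ = x at hx hM
  have hx' : ∑ i, x i * star (x i) = 1 := by
    have := congrArg (fun r : ℝ => (r : ℂ)) hx
    simpa [Complex.mul_conj] using this
  have hcx := eigenvalue_eq hμ hx hM
  have hMsq : Mmat μ *ᵥ mul μ x x = (cconst μ : ℂ) • mul μ x x := by
    rw [mulVec_mul_self (glAct_Mmat_of_isSoliton hμ hsol) hM]
    congr 1
    ring
  set s := ∑ k, star (x k) * mul μ x x k with hs
  set w := mul μ x x - s • x with hw
  have hMw : Mmat μ *ᵥ w = (cconst μ : ℂ) • w := by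
    rw [hw, Matrix.mulVec_sub, Matrix.mulVec_smul, hMsq, hM, smul_sub, smul_comm s]
  have hwx : ∑ i, w i * star (x i) = 0 := by
    have e : ∑ i, mul μ x x i * star (x i) = s := by
      rw [hs]
      exact Finset.sum_congr rfl fun i _ => mul_comm _ _
    simp only [hw, Pi.sub_apply, Pi.smul_apply, smul_eq_mul, sub_mul, mul_assoc,
      Finset.sum_sub_distrib, ← Finset.mul_sum, e, hx', mul_one, sub_self]
  by_cases hw0 : w = 0
  · have hsq : mul μ x x = s • x := sub_eq_zero.1 hw0
    have h1 := two_mul_leftNormSq_le hμ hx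
    have h2 := normSq_inner_mul_self_le μ hx
    rw [← hs] at h2
    have h3 : ∑ k, Complex.normSq (mul μ x x k) = Complex.normSq s := by
      simp only [hsq, Pi.smul_apply, smul_eq_mul, Complex.normSq_mul, ← Finset.mul_sum, hx,
        mul_one]
    linarith
  · obtain ⟨t, hy⟩ := exists_smul_unit hw0
    have hMy : Mmat μ *ᵥ (t • w) = (cconst μ : ℂ) • (t • w) := by
      rw [Matrix.mulVec_smul, hMw, smul_comm]
    have hyx : ∑ i, (t • w) i * star (x i) = 0 := by
      simp only [Pi.smul_apply, smul_eq_mul, mul_assoc, ← Finset.mul_sum, hwx, mul_zero]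
    have h1 := leftNormSq_add_le μ hx hy hyx
    have h2 := eigenvalue_eq hμ hy hMy
    have h3 := compNormSq_nonneg μ x
    have h4 := compNormSq_nonneg μ (t • w)
    linarith

end Vn

/-- if `μ` is a nonzero soliton and `0` is an eigenvalue of `D_μ`, then
`E_n(μ) ≤ 1`, i.e. `‖M_μ‖ ≤ ‖μ‖²`. -/
theorem stmt15 {n : ℕ} (μ : Vn n) (hμ : Vn.IsSymm μ) (hsol : Vn.IsSoliton μ)
    (hker : ∃ x : Fin n → ℂ, x ≠ 0 ∧ Vn.Dmat μ *ᵥ x = 0) :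
    Vn.energy μ ≤ 1 ∧ fnormSq (Vn.Mmat μ) ≤ (Vn.normSqV μ) ^ 2 := by
  have hpos := Vn.normSqV_pos hsol.1
  have h := Vn.neg_cconst_le hμ hsol hker
  have key : (Matrix.trace (Vn.Mmat μ * Vn.Mmat μ)).re ≤ Vn.normSqV μ ^ 2 := by
    rwa [Vn.cconst, neg_div, neg_neg, div_le_iff₀ hpos, ← sq (Vn.normSqV μ)] at h
  refine ⟨?_, ?_⟩
  · rw [Vn.energy]
    exact div_le_one_of_le₀ key (sq_nonneg _)
  · rwa [fnormSq, Vn.Mmat_conjTranspose]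
end
end

section
/- Let μ ∈ 𝒥_n be a soliton whose underlying algebra satisfies 𝔄³ = 0, i.e., μ(μ(x,y),z) = 0 for all x, y, z ∈ ℂⁿ. Then D_μ := M_μ − c_μ·I (with c_μ := −Tr(M_μ²)/‖μ‖²) is positive definite: all eigenvalues of D_μ are positive. -/
open Matrix

noncomputable section

namespace Vn

variable {n : ℕ}

/-- left multiplication by the `i`-th standard basis vector -/
def basisL (μ : Vn n) (i : Fin n) : Matrix (Fin n) (Fin n) ℂ := L μ (Pi.single i 1)

/-- the action of `gl(n, ℂ)` on algebras, written in terms of the left multiplications by the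
standard basis vectors -/
def famAct (A : Matrix (Fin n) (Fin n) ℂ) (T : Fin n → Matrix (Fin n) (Fin n) ℂ) :
    Fin n → Matrix (Fin n) (Fin n) ℂ :=
  fun i => A * T i - T i * A - ∑ l, A l i • T l

/-- the Hermitian product on families of matrices -/
def famInner (S T : Fin n → Matrix (Fin n) (Fin n) ℂ) : ℂ := ∑ i, trace (S i * (T i)ᴴ)

lemma basisL_apply (μ : Vn n) (i k j : Fin n) : basisL μ i k j = μ i j k := by
  simp [basisL, L, Pi.single_apply]

lemma L_eq_sum (μ : Vn n) (x : Fin n → ℂ) : L μ x = ∑ i, x i • basisL μ i := by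
  ext k j
  simp [Matrix.sum_apply, basisL_apply, L]

lemma L_mulVec (μ : Vn n) (x y : Fin n → ℂ) : L μ x *ᵥ y = mul μ x y := by
  ext k
  simp only [mulVec, dotProduct, L, of_apply, mul, Finset.sum_mul]
  rw [Finset.sum_comm]
  exact Finset.sum_congr rfl fun i _ => Finset.sum_congr rfl fun j _ => by ring

lemma mul_comm_of_isSymm {μ : Vn n} (h : IsSymm μ) (x y : Fin n → ℂ) :
    mul μ x y = mul μ y x := by
  ext k
  simp only [mul]
  rw [Finset.sum_comm]
  exact Finset.sum_congr rfl fun i _ => Finset.sum_congr rfl fun j _ => by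
    rw [h j i k]; ring

lemma mul_single_single (μ : Vn n) (i j : Fin n) :
    mul μ (Pi.single i 1) (Pi.single j 1) = fun k => μ i j k := by
  ext k
  rw [← L_mulVec]
  simpa [basisL] using basisL_apply μ i k j

lemma basisL_glAct {μ : Vn n} (A : Matrix (Fin n) (Fin n) ℂ) :
    basisL (glAct A μ) = famAct A (basisL μ) := by
  ext i k j
  have h1 : (A *ᵥ mul μ (Pi.single i 1) (Pi.single j 1)) k = (A * basisL μ i) k j := by
    rw [mul_single_single]
    simp [Matrix.mul_apply, mulVec, dotProduct, basisL_apply]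
  have h2 : mul μ (A *ᵥ Pi.single i 1) (Pi.single j 1) k = (∑ l, A l i • basisL μ l) k j := by
    rw [← L_mulVec, L_eq_sum]
    simp
  have h3 : mul μ (Pi.single i 1) (A *ᵥ Pi.single j 1) k = (basisL μ i * A) k j := by
    rw [← L_mulVec, mulVec_mulVec]
    simp [basisL]
  rw [basisL_apply]
  simp only [glAct, famAct, Pi.sub_apply, Matrix.sub_apply, h1, h2, h3]
  ring

lemma Mmat_eq (μ : Vn n) : Mmat μ = (-2 : ℂ) • ∑ i, (basisL μ i)ᴴ * basisL μ i
    + ∑ i, basisL μ i * (basisL μ i)ᴴ := rfl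

lemma isHermitian_Mmat (μ : Vn n) : (Mmat μ).IsHermitian := by
  simp [Matrix.IsHermitian, Mmat_eq, conjTranspose_sum]

lemma famInner_self (μ : Vn n) : famInner (basisL μ) (basisL μ) = (normSqV μ : ℂ) := by
  simp only [famInner, normSqV, trace, diag_apply, Matrix.mul_apply, conjTranspose_apply,
    basisL_apply, Complex.ofReal_sum]
  refine Finset.sum_congr rfl fun i _ => ?_
  rw [Finset.sum_comm]
  exact Finset.sum_congr rfl fun j _ => Finset.sum_congr rfl fun k _ => Complex.mul_conj _

lemma sum_smul_famInner {μ : Vn n} (h : IsSymm μ) (A : Matrix (Fin n) (Fin n) ℂ) :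
    ∑ i, trace ((∑ l, A l i • basisL μ l) * (basisL μ i)ᴴ)
      = ∑ i, trace (basisL μ i * A * (basisL μ i)ᴴ) := by
  simp only [trace, diag_apply, Matrix.mul_apply, conjTranspose_apply, Matrix.sum_apply,
    Matrix.smul_apply, basisL_apply, Finset.sum_mul, smul_eq_mul]
  rw [Finset.sum_comm]
  conv_rhs => rw [Finset.sum_comm]
  refine Finset.sum_congr rfl fun k _ => ?_
  rw [Finset.sum_congr rfl fun i _ => Finset.sum_comm, Finset.sum_comm]
  refine Finset.sum_congr rfl fun i _ => Finset.sum_congr rfl fun j _ =>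
    Finset.sum_congr rfl fun l _ => ?_
  rw [h l i k, h j i k]
  ring

/-- the defining property of the moment matrix: `Tr (M_μ A) = ⟨A·μ, μ⟩` -/
lemma trace_Mmat_mul {μ : Vn n} (h : IsSymm μ) (A : Matrix (Fin n) (Fin n) ℂ) :
    trace (Mmat μ * A) = famInner (famAct A (basisL μ)) (basisL μ) := by
  have h1 : ∀ i, trace ((basisL μ i)ᴴ * basisL μ i * A)
      = trace (basisL μ i * A * (basisL μ i)ᴴ) := fun i => by
    rw [Matrix.mul_assoc, trace_mul_comm]
  have h2 : ∀ i, trace (basisL μ i * (basisL μ i)ᴴ * A)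
      = trace (A * basisL μ i * (basisL μ i)ᴴ) := fun i => by
    rw [trace_mul_comm, Matrix.mul_assoc]
  simp only [famInner, famAct, Matrix.sub_mul, trace_sub, Finset.sum_sub_distrib,
    sum_smul_famInner h]
  simp only [Mmat_eq, Matrix.add_mul, Matrix.smul_mul, Finset.sum_mul, trace_add, trace_smul,
    trace_sum, h1, h2, smul_eq_mul]
  ring

lemma famAct_commutator (A B : Matrix (Fin n) (Fin n) ℂ)
    (T : Fin n → Matrix (Fin n) (Fin n) ℂ) :
    famAct (A * B - B * A) T = famAct A (famAct B T) - famAct B (famAct A T) := by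
  have key : ∀ (A B : Matrix (Fin n) (Fin n) ℂ) (i : Fin n),
      ∑ l, (A * B) l i • T l = ∑ m, B m i • ∑ l, A l m • T l := fun A B i => by
    simp only [Matrix.mul_apply, Finset.sum_smul, Finset.smul_sum, smul_smul]
    rw [Finset.sum_comm]
    exact Finset.sum_congr rfl fun i _ => Finset.sum_congr rfl fun j _ => by rw [mul_comm]
  funext i
  simp only [famAct, Pi.sub_apply, Matrix.sub_apply, sub_smul, Finset.sum_sub_distrib, key,
    smul_sub, Matrix.mul_sub, Matrix.sub_mul, Finset.mul_sum, Finset.sum_mul, Matrix.mul_smul,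
    Matrix.smul_mul, Matrix.mul_assoc]
  abel

lemma famAct_zero (A : Matrix (Fin n) (Fin n) ℂ) : famAct A 0 = 0 := by
  funext i
  simp [famAct]

lemma famInner_famAct (A : Matrix (Fin n) (Fin n) ℂ) (S T : Fin n → Matrix (Fin n) (Fin n) ℂ) :
    famInner (famAct A S) T = famInner S (famAct Aᴴ T) := by
  have h1 : ∀ i, trace (A * (S i * (T i)ᴴ)) = trace (S i * ((T i)ᴴ * A)) := fun i => by
    rw [trace_mul_comm, Matrix.mul_assoc]
  simp only [famInner, famAct, conjTranspose_sub, conjTranspose_mul, conjTranspose_conjTranspose,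
    Matrix.sub_mul, Matrix.mul_sub, trace_sub, Finset.sum_sub_distrib, conjTranspose_sum,
    conjTranspose_smul, Finset.sum_mul, Finset.mul_sum, Matrix.smul_mul, Matrix.mul_smul,
    trace_sum, trace_smul, conjTranspose_apply, star_star, Matrix.mul_assoc]
  congr 1
  · congr 1
    exact Finset.sum_congr rfl fun i _ => h1 i
  · rw [Finset.sum_comm]

open scoped ComplexOrder in
lemma famInner_self_nonneg (S : Fin n → Matrix (Fin n) (Fin n) ℂ) : 0 ≤ famInner S S :=
  Finset.sum_nonneg fun i _ => (posSemidef_self_mul_conjTranspose (S i)).trace_nonneg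

open scoped ComplexOrder in
lemma eq_zero_of_famInner_self {S : Fin n → Matrix (Fin n) (Fin n) ℂ} (h : famInner S S = 0) :
    S = 0 := by
  funext i
  exact trace_mul_conjTranspose_self_eq_zero_iff.1 ((Finset.sum_eq_zero_iff_of_nonneg
    fun i _ => (posSemidef_self_mul_conjTranspose (S i)).trace_nonneg).1 h i (Finset.mem_univ i))

lemma L_mul_L_eq_zero {μ : Vn n} (h : IsSymm μ) (hcube : ∀ x y z, mul μ (mul μ x y) z = 0)
    (x y : Fin n → ℂ) : L μ x * L μ y = 0 := by
  refine Matrix.ext_of_mulVec_single fun j => ?_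
  rw [← mulVec_mulVec, L_mulVec, L_mulVec, mul_comm_of_isSymm h, hcube, zero_mulVec]

lemma L_mul_eq_zero {μ : Vn n} (hcube : ∀ x y z, mul μ (mul μ x y) z = 0)
    (x y : Fin n → ℂ) : L μ (mul μ x y) = 0 := by
  refine Matrix.ext_of_mulVec_single fun j => ?_
  rw [L_mulVec, hcube, zero_mulVec]

/-- if `𝔄³ = 0`, then every left multiplication is a derivation -/
lemma famAct_L {μ : Vn n} (h : IsSymm μ) (hcube : ∀ x y z, mul μ (mul μ x y) z = 0)
    (x : Fin n → ℂ) : famAct (L μ x) (basisL μ) = 0 := by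
  funext i
  have h3 : ∑ l, L μ x l i • basisL μ l = 0 := by
    rw [← L_mul_eq_zero hcube x (Pi.single i 1), L_eq_sum μ (mul μ x _), ← L_mulVec]
    simp
  simp only [famAct, h3]
  simp only [basisL, L_mul_L_eq_zero h hcube]
  simp

open scoped ComplexOrder in
/-- if `𝔄³ = 0` and the adjoint of `L_x` is a derivation, then `L_x = 0` -/
lemma L_eq_zero_of_famAct_conjTranspose {μ : Vn n} (h : IsSymm μ)
    (hcube : ∀ x y z, mul μ (mul μ x y) z = 0) {x : Fin n → ℂ}
    (hx : famAct (L μ x)ᴴ (basisL μ) = 0) : L μ x = 0 := by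
  have h1 : ∀ i, L μ x * (L μ x)ᴴ * basisL μ i = 0 := fun i => by
    have h2 := congrArg (L μ x * ·) (congrFun hx i)
    simp only [famAct, basisL, Matrix.mul_sub, Matrix.mul_sum, Matrix.mul_smul,
      ← Matrix.mul_assoc, L_mul_L_eq_zero h hcube] at h2
    simpa [basisL] using h2
  have h3 : L μ x * (L μ x)ᴴ * L μ x = 0 := by
    nth_rewrite 3 [L_eq_sum μ x]
    simp [Matrix.mul_sum, h1]
  rwa [self_mul_conjTranspose_mul_eq_zero, conjTranspose_mul_self_eq_zero] at h3

lemma famAct_Mmat {μ : Vn n} {c : ℝ} (hc : glAct (Mmat μ) μ = (c : ℂ) • μ) :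
    famAct (Mmat μ) (basisL μ) = (c : ℂ) • basisL μ := by
  rw [← basisL_glAct, hc]
  ext i k j
  simp [basisL_apply]

lemma famInner_smul_left (c : ℂ) (S T : Fin n → Matrix (Fin n) (Fin n) ℂ) :
    famInner (c • S) T = c * famInner S T := by
  simp [famInner, Finset.mul_sum]

lemma trace_Mmat_sq {μ : Vn n} (h : IsSymm μ) {c : ℝ}
    (hc : glAct (Mmat μ) μ = (c : ℂ) • μ) :
    trace (Mmat μ * Mmat μ) = ((c * normSqV μ : ℝ) : ℂ) := by
  rw [trace_Mmat_mul h, famAct_Mmat hc, famInner_smul_left, famInner_self]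
  push_cast
  rfl

lemma cconst_eq_neg {μ : Vn n} (h : IsSymm μ) (h0 : μ ≠ 0) {c : ℝ}
    (hc : glAct (Mmat μ) μ = (c : ℂ) • μ) : cconst μ = -c := by
  have := (normSqV_pos h0).ne'
  rw [cconst, trace_Mmat_sq h hc, Complex.ofReal_re]
  field_simp

lemma trace_Mmat {μ : Vn n} (h : IsSymm μ) : trace (Mmat μ) = -(normSqV μ : ℂ) := by
  have h1 : famAct 1 (basisL μ) = (-1 : ℂ) • basisL μ := by
    funext i
    simp [famAct, Matrix.one_apply]
  rw [← Matrix.mul_one (Mmat μ), trace_Mmat_mul h, h1, famInner_smul_left, famInner_self]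
  ring

open scoped ComplexOrder in
lemma soliton_constant_pos {μ : Vn n} (h : IsSymm μ) (h0 : μ ≠ 0) {c : ℝ}
    (hc : glAct (Mmat μ) μ = (c : ℂ) • μ) : 0 < c := by
  have hN := normSqV_pos h0
  have hM : Mmat μ * (Mmat μ)ᴴ = Mmat μ * Mmat μ := by rw [(isHermitian_Mmat μ).eq]
  have h1 : 0 ≤ trace (Mmat μ * (Mmat μ)ᴴ) :=
    (posSemidef_self_mul_conjTranspose _).trace_nonneg
  have h2 : trace (Mmat μ * (Mmat μ)ᴴ) ≠ 0 := fun h2 => by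
    have h3 := trace_Mmat h
    rw [trace_mul_conjTranspose_self_eq_zero_iff.1 h2, trace_zero, eq_comm, neg_eq_zero] at h3
    exact hN.ne' (by exact_mod_cast h3)
  have h3 := lt_of_le_of_ne h1 h2.symm
  rw [hM, trace_Mmat_sq h hc] at h3
  exact pos_of_mul_pos_left (by exact_mod_cast h3) hN.le

open scoped ComplexOrder in
lemma dotProduct_Mmat_nonneg {μ : Vn n} (h : IsSymm μ) {x : Fin n → ℂ} (hx : L μ x = 0) :
    0 ≤ star x ⬝ᵥ (Mmat μ *ᵥ x) := by
  have h1 : ∀ i, basisL μ i *ᵥ x = 0 := fun i => by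
    rw [basisL, L_mulVec, mul_comm_of_isSymm h, ← L_mulVec, hx, zero_mulVec]
  simp only [Mmat_eq, add_mulVec, smul_mulVec, sum_mulVec, ← mulVec_mulVec, h1, mulVec_zero,
    Finset.sum_const_zero, smul_zero, zero_add, dotProduct_sum]
  refine Finset.sum_nonneg fun i _ => ?_
  rw [mulVec_mulVec]
  exact (posSemidef_self_mul_conjTranspose (basisL μ i)).dotProduct_mulVec_nonneg x

lemma trace_Mmat_commutator {μ : Vn n} (h : IsSymm μ) {E : Matrix (Fin n) (Fin n) ℂ}
    (hE : famAct E (basisL μ) = 0) :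
    trace ((Mmat μ * E - E * Mmat μ) * Eᴴ)
      = famInner (famAct Eᴴ (basisL μ)) (famAct Eᴴ (basisL μ)) := by
  have h1 : trace ((Mmat μ * E - E * Mmat μ) * Eᴴ) = trace (Mmat μ * (E * Eᴴ - Eᴴ * E)) := by
    rw [Matrix.sub_mul, Matrix.mul_sub, trace_sub, trace_sub, Matrix.mul_assoc,
      Matrix.mul_assoc E, trace_mul_comm E, Matrix.mul_assoc (Mmat μ) Eᴴ]
  rw [h1, trace_Mmat_mul h, famAct_commutator, hE, famAct_zero, sub_zero, famInner_famAct]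

lemma Mmat_commutator_L {μ : Vn n} {c : ℝ} (hc : glAct (Mmat μ) μ = (c : ℂ) • μ)
    {d : ℂ} {x : Fin n → ℂ} (hx : Mmat μ *ᵥ x = (d - c) • x) :
    Mmat μ * L μ x - L μ x * Mmat μ = d • L μ x := by
  have h1 : L μ (Mmat μ *ᵥ x) = ∑ i, x i • ∑ l, Mmat μ l i • basisL μ l := by
    simp only [L_eq_sum μ (Mmat μ *ᵥ x), mulVec, dotProduct, Finset.sum_smul, Finset.smul_sum,
      smul_smul]
    rw [Finset.sum_comm]
    exact Finset.sum_congr rfl fun i _ => Finset.sum_congr rfl fun j _ => by rw [mul_comm]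
  have h2 : L μ (Mmat μ *ᵥ x) = (d - c) • L μ x := by
    rw [hx, L_eq_sum, L_eq_sum, Finset.smul_sum]
    simp [smul_smul]
  have h3 : ∑ i, x i • famAct (Mmat μ) (basisL μ) i = (c : ℂ) • L μ x := by
    rw [famAct_Mmat hc, L_eq_sum, Finset.smul_sum]
    exact Finset.sum_congr rfl fun i _ => smul_comm (x i) (c : ℂ) (basisL μ i)
  have h4 : ∑ i, x i • famAct (Mmat μ) (basisL μ) i
      = Mmat μ * L μ x - L μ x * Mmat μ - L μ (Mmat μ *ᵥ x) := by
    rw [h1, L_eq_sum μ x]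
    simp only [famAct, smul_sub, Finset.sum_sub_distrib, Matrix.mul_sum, Matrix.sum_mul,
      Matrix.mul_smul, Matrix.smul_mul]
  rw [h3, h2, sub_smul] at h4
  simpa using (eq_sub_iff_add_eq.1 h4).symm

end Vn

/-- if `μ ∈ 𝒥_n` is a soliton with `𝔄³ = 0`, then all eigenvalues of `D_μ`
are positive (in particular real). -/
theorem stmt18 {n : ℕ} (μ : Vn n) (hJ : Vn.IsJordan μ) (hsol : Vn.IsSoliton μ)
    (hcube : ∀ x y z, Vn.mul μ (Vn.mul μ x y) z = 0) :
    ∀ (d : ℂ) (x : Fin n → ℂ), x ≠ 0 → Vn.Dmat μ *ᵥ x = d • x →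
      0 < d.re ∧ d.im = 0 := by
  open scoped ComplexOrder in
  obtain ⟨hS, -⟩ := hJ
  obtain ⟨h0, c, hc⟩ := hsol
  have hcpos : (0 : ℂ) < c := by exact_mod_cast Vn.soliton_constant_pos hS h0 hc
  intro d x hx hd
  have hM : Vn.Mmat μ *ᵥ x = (d - c) • x := by
    rw [Vn.Dmat, Vn.cconst_eq_neg hS h0 hc, sub_mulVec, smul_mulVec, one_mulVec] at hd
    rw [sub_smul, ← hd]
    simp
  suffices hpos : 0 < d from ⟨(Complex.lt_def.1 hpos).1, (Complex.lt_def.1 hpos).2.symm⟩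
  by_cases hL : Vn.L μ x = 0
  · have h1 := Vn.dotProduct_Mmat_nonneg hS hL
    rw [hM, dotProduct_smul, smul_eq_mul] at h1
    have h2 : 0 < star x ⬝ᵥ x := dotProduct_star_self_pos_iff.2 hx
    have h3 : 0 ≤ d - c := le_of_mul_le_mul_right (by simpa using h1) h2
    exact hcpos.trans_le (sub_nonneg.1 h3)
  · have h1 := Vn.trace_Mmat_commutator hS (Vn.famAct_L hS hcube x)
    rw [Vn.Mmat_commutator_L hc hM, Matrix.smul_mul, trace_smul, smul_eq_mul] at h1
    have h2 : 0 ≤ trace (Vn.L μ x * (Vn.L μ x)ᴴ) :=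
      (posSemidef_self_mul_conjTranspose _).trace_nonneg
    have h3 := lt_of_le_of_ne (Vn.famInner_self_nonneg _) fun h =>
      hL (Vn.L_eq_zero_of_famAct_conjTranspose hS hcube (Vn.eq_zero_of_famInner_self h.symm))
    rw [← h1] at h3
    exact pos_of_mul_pos_left h3 h2
end
end
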